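/- Let N be a positive integer and let B and E be commuting N×N Hermitian complex matrices with ‖B − I‖_op ≤ 1/4 and ‖E‖_op ≤ 1/8. Then B and B + E are invertible, and ‖(B + E)^{-1} + E − B^{-1}‖_F ≤ 8·(‖B − I‖_op + ‖E‖_op)·‖E‖_F. -/

import Mathlib

open Matrix

/-- The operator norm of a complex `N × N` matrix, with respect to the Euclidean norm on
`ℂ^N`. -/
noncomputable def opNorm {N : ℕ} (M : Matrix (Fin N) (Fin N) ℂ) : ℝ :=
  ‖Matrix.toEuclideanCLM (𝕜 := ℂ) M‖

/-- The Frobenius (Hilbert–Schmidt) norm `‖M‖_F = (tr(Mᴴ M))^{1/2}`. -/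
noncomputable def frobNorm {N : ℕ} (M : Matrix (Fin N) (Fin N) ℂ) : ℝ :=
  Real.sqrt (Matrix.trace (Mᴴ * M)).re

open scoped Matrix.Norms.L2Operator in
theorem opNorm_eq_norm {N : ℕ} (M : Matrix (Fin N) (Fin N) ℂ) : opNorm M = ‖M‖ := rfl

theorem re_trace_conjTranspose_mul_self {N : ℕ} (M : Matrix (Fin N) (Fin N) ℂ) :
    (Matrix.trace (Mᴴ * M)).re = ∑ j, ‖WithLp.toLp 2 (M.col j)‖ ^ 2 := by
  simp only [Matrix.trace, Matrix.diag_apply, Matrix.mul_apply, Matrix.conjTranspose_apply,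
    Complex.re_sum, EuclideanSpace.norm_sq_eq, Matrix.col_apply, RCLike.star_def,
    Complex.conj_mul']
  norm_cast

theorem frobNorm_mul_le {N : ℕ} (A M : Matrix (Fin N) (Fin N) ℂ) :
    frobNorm (A * M) ≤ opNorm A * frobNorm M := by
  have h0 : 0 ≤ opNorm A := norm_nonneg _
  refine Real.sqrt_le_iff.mpr ⟨mul_nonneg h0 (Real.sqrt_nonneg _), ?_⟩
  have hM : 0 ≤ (Matrix.trace (Mᴴ * M)).re := by
    rw [re_trace_conjTranspose_mul_self]
    positivity
  rw [mul_pow, frobNorm, Real.sq_sqrt hM, re_trace_conjTranspose_mul_self,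
    re_trace_conjTranspose_mul_self, Finset.mul_sum]
  refine Finset.sum_le_sum fun j _ => ?_
  rw [← mul_pow]
  refine pow_le_pow_left₀ (norm_nonneg _) ?_ 2
  exact (Matrix.toEuclideanCLM (𝕜 := ℂ) A).le_opNorm (WithLp.toLp 2 (M.col j))

section NormedRing

variable {R : Type*} [NormedRing R]

theorem isUnit_of_norm_sub_one_lt_one [HasSummableGeomSeries R] {a : R} (h : ‖a - 1‖ < 1) :
    IsUnit a := by
  have := isUnit_one_sub_of_norm_lt_one (x := 1 - a) (by rwa [norm_sub_rev])
  simpa using this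

theorem norm_le_of_mul_eq_one [NormOneClass R] {a x : R} {r : ℝ} (hax : a * x = 1) (ha : ‖a - 1‖ ≤ r)
    (hr : r < 1) : ‖x‖ ≤ (1 - r)⁻¹ := by
  have hx : x = 1 - (a - 1) * x := by rw [sub_mul, hax, one_mul]; abel
  have h : ‖x‖ ≤ 1 + r * ‖x‖ := by
    calc ‖x‖ = ‖1 - (a - 1) * x‖ := by rw [← hx]
      _ ≤ ‖(1 : R)‖ + ‖(a - 1) * x‖ := norm_sub_le _ _
      _ ≤ 1 + r * ‖x‖ := by
        rw [norm_one]
        gcongr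
        exact (norm_mul_le _ _).trans (by gcongr)
  rw [← one_div, le_div_iff₀ (by linarith)]
  linarith

theorem norm_one_sub_mul_le {b e x y : R} (hyx : y * (b + e) = 1) (hxb : x * b = 1)
    (hx : ‖x‖ ≤ 4 / 3) (hy : ‖y‖ ≤ 8 / 5) (hb : ‖b - 1‖ ≤ 1 / 4) :
    ‖1 - x * y‖ ≤ 8 * (‖b - 1‖ + ‖e‖) := by
  have hfact : 1 - x * y = x * y * ((b + e) * b - 1) := by
    rw [mul_sub, mul_one, mul_assoc x y, ← mul_assoc y, hyx, one_mul, hxb]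
  have hsplit : (b + e) * b - 1 = (b - 1) + (b - 1) + (b - 1) * (b - 1) + (e * (b - 1) + e) := by
    noncomm_ring
  have hdiff : ‖(b + e) * b - 1‖ ≤ 9 / 4 * ‖b - 1‖ + 5 / 4 * ‖e‖ := by
    rw [hsplit]
    have h1 := norm_mul_le (b - 1) (b - 1)
    have h2 := norm_mul_le e (b - 1)
    have h3 := norm_add_le (b - 1 + (b - 1) + (b - 1) * (b - 1)) (e * (b - 1) + e)
    have h4 := norm_add_le (b - 1 + (b - 1)) ((b - 1) * (b - 1))
    have h5 := norm_add_le (b - 1) (b - 1)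
    have h6 := norm_add_le (e * (b - 1)) e
    nlinarith [norm_nonneg (b - 1), norm_nonneg e]
  calc ‖1 - x * y‖ ≤ ‖x‖ * ‖y‖ * ‖(b + e) * b - 1‖ := by
        rw [hfact]
        exact (norm_mul_le _ _).trans (by gcongr; exact norm_mul_le _ _)
    _ ≤ 4 / 3 * (8 / 5) * (9 / 4 * ‖b - 1‖ + 5 / 4 * ‖e‖) := by gcongr
    _ ≤ 8 * (‖b - 1‖ + ‖e‖) := by linarith [norm_nonneg (b - 1), norm_nonneg e]

end NormedRing

open scoped Matrix.Norms.L2Operator in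
/-- For commuting Hermitian matrices `B`, `E` with `‖B − I‖_op ≤ 1/4` and
`‖E‖_op ≤ 1/8`, both `B` and `B + E` are invertible and
`‖(B+E)⁻¹ + E − B⁻¹‖_F ≤ 8(‖B − I‖_op + ‖E‖_op)‖E‖_F`. -/
theorem perturbed_inverse_estimate
    (N : ℕ) (hN : 0 < N) (B E : Matrix (Fin N) (Fin N) ℂ)
    (hB : B.IsHermitian) (hE : E.IsHermitian) (hcomm : Commute B E)
    (hBop : opNorm (B - 1) ≤ 1 / 4) (hEop : opNorm E ≤ 1 / 8) :
    IsUnit B ∧ IsUnit (B + E) ∧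
      frobNorm ((B + E)⁻¹ + E - B⁻¹)
        ≤ 8 * (opNorm (B - 1) + opNorm E) * frobNorm E := by
  have : NeZero N := ⟨hN.ne'⟩
  have hcompl : CompleteSpace (Matrix (Fin N) (Fin N) ℂ) := FiniteDimensional.complete ℂ _
  rw [opNorm_eq_norm] at hBop hEop
  have hBE : ‖B + E - 1‖ ≤ 3 / 8 := by
    rw [add_sub_right_comm]
    linarith [norm_add_le (B - 1) E]
  have hBu : IsUnit B := isUnit_of_norm_sub_one_lt_one (by linarith)
  have hBEu : IsUnit (B + E) := isUnit_of_norm_sub_one_lt_one (by linarith)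
  refine ⟨hBu, hBEu, ?_⟩
  have hBdet := (Matrix.isUnit_iff_isUnit_det B).mp hBu
  have hBEdet := (Matrix.isUnit_iff_isUnit_det (B + E)).mp hBEu
  have hx : ‖B⁻¹‖ ≤ 4 / 3 :=
    (norm_le_of_mul_eq_one (Matrix.mul_nonsing_inv B hBdet) hBop (by norm_num)).trans
      (by norm_num)
  have hy : ‖(B + E)⁻¹‖ ≤ 8 / 5 :=
    (norm_le_of_mul_eq_one (Matrix.mul_nonsing_inv (B + E) hBEdet) hBE (by norm_num)).trans
      (by norm_num)
  have hEinv : (B + E)⁻¹ * E = E * (B + E)⁻¹ := by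
    have hc : (B + E) * E = E * (B + E) := (hcomm.add_left (Commute.refl E)).eq
    calc (B + E)⁻¹ * E = (B + E)⁻¹ * (E * (B + E)) * (B + E)⁻¹ := by
          rw [mul_assoc, mul_assoc E, Matrix.mul_nonsing_inv _ hBEdet, mul_one]
      _ = E * (B + E)⁻¹ := by
          rw [← hc, ← mul_assoc, Matrix.nonsing_inv_mul _ hBEdet, one_mul]
  have hresolvent : B⁻¹ * E * (B + E)⁻¹ = B⁻¹ - (B + E)⁻¹ := by
    calc B⁻¹ * E * (B + E)⁻¹ = B⁻¹ * ((B + E) - B) * (B + E)⁻¹ := by rw [add_sub_cancel_left]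
      _ = B⁻¹ - (B + E)⁻¹ := by
          rw [mul_sub, sub_mul, Matrix.nonsing_inv_mul _ hBdet, one_mul, mul_assoc,
            Matrix.mul_nonsing_inv _ hBEdet, mul_one]
  have hfactor : (B + E)⁻¹ + E - B⁻¹ = (1 - B⁻¹ * (B + E)⁻¹) * E := by
    rw [sub_mul, one_mul, mul_assoc, hEinv, ← mul_assoc, hresolvent]
    abel
  rw [hfactor]
  refine (frobNorm_mul_le _ _).trans ?_
  refine mul_le_mul_of_nonneg_right ?_ (Real.sqrt_nonneg _)
  exact norm_one_sub_mul_le (Matrix.nonsing_inv_mul _ hBEdet)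
    (Matrix.nonsing_inv_mul _ hBdet) hx hy hBop
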